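/- arXiv:2011.00465 — 2 statements merged into one kernel-verified Lean document; each statement's English description precedes it below -/
import Mathlib

section
/- Let φ ∈ C_c^∞(ℝ^n) satisfy supp φ ⊂ Q and φ(ξ) = 1 for ξ ∈ 2^{-1}Q, and set Φ(ξ,η) = φ(ξ)φ(η). Then there exists a constant c ∈ (0,∞), depending only on n and φ, such that for every L^∞ matrix A = (a_{μν})_{μ,ν∈ℤ^n} one has ‖σ_{A,Φ}‖_{M(L²×L² → (L²,ℓ^∞))} ≥ c^{-1} ‖A‖_B. -/
open MeasureTheory Complex
open scoped ENNReal NNReal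

noncomputable section

abbrev Rn (n : ℕ) : Type := Fin n → ℝ
abbrev Zn (n : ℕ) : Type := Fin n → ℤ

/-- Coercion of a lattice point to a point of `ℝ^n`. -/
def coeZ {n : ℕ} (μ : Zn n) : Rn n := fun i => (μ i : ℝ)

/-- The cube `aQ = [-a/2, a/2]^n`. -/
def cube (n : ℕ) (a : ℝ) : Set (Rn n) := Set.univ.pi fun _ => Set.Icc (-a / 2) (a / 2)

/-- A smooth compactly supported function. -/
def IsCcInfty {E : Type*} [NormedAddCommGroup E] [NormedSpace ℝ E] (Φ : E → ℂ) : Prop :=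
  ContDiff ℝ (⊤ : ℕ∞) Φ ∧ HasCompactSupport Φ

/-- The Fourier transform of a Schwartz function. -/
def ft {n : ℕ} (f : SchwartzMap (Rn n) ℂ) (ξ : Rn n) : ℂ :=
  ∫ x : Rn n, Complex.exp ((-2 * Real.pi * Complex.I) * ((∑ i, x i * ξ i : ℝ) : ℂ)) * f x

/-- The bilinear Fourier multiplier operator `T_σ(f,g)`. -/
def Tbil {n : ℕ} (σ : Rn n × Rn n → ℂ) (f g : SchwartzMap (Rn n) ℂ) (x : Rn n) : ℂ :=
  ∫ p : Rn n × Rn n,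
    Complex.exp ((2 * Real.pi * Complex.I) * ((∑ i, x i * (p.1 i + p.2 i) : ℝ) : ℂ)) *
      σ p * ft f p.1 * ft g p.2

/-- `L²` norm of `h(·+ν)` on the unit cube `Q`. -/
def localL2 {n : ℕ} (h : Rn n → ℂ) (ν : Zn n) : ℝ≥0∞ :=
  (∫⁻ x in cube n 1, (‖h (x + coeZ ν)‖₊ : ℝ≥0∞) ^ 2) ^ (1 / 2 : ℝ)

/-- The amalgam `(L², ℓ^q)` norm. -/
def amalgamNorm {n : ℕ} (q : ℝ≥0∞) (h : Rn n → ℂ) : ℝ≥0∞ :=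
  if q = ∞ then ⨆ ν : Zn n, localL2 h ν
  else (∑' ν : Zn n, localL2 h ν ^ q.toReal) ^ (1 / q.toReal)

/-- The multiplier norm `‖σ‖_{M(L²×L² → (L²,ℓ^q))}`. -/
def multNorm {n : ℕ} (q : ℝ≥0∞) (σ : Rn n × Rn n → ℂ) : ℝ≥0∞ :=
  ⨆ (f : SchwartzMap (Rn n) ℂ) (g : SchwartzMap (Rn n) ℂ)
    (_ : eLpNorm (⇑f) 2 volume = 1) (_ : eLpNorm (⇑g) 2 volume = 1),
    amalgamNorm q (Tbil σ f g)

/-- An `L^∞` matrix on `ℤ^n × ℤ^n`. -/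
def IsLinftyMatrix {n : ℕ} (A : Zn n → Zn n → ℂ) : Prop :=
  ∃ C : ℝ, ∀ μ ν, ‖A μ ν‖ ≤ C

/-- The norm `‖A‖_B`: the trilinear form norm over finitely supported unit `ℓ²` vectors. -/
def normB {n : ℕ} (A : Zn n → Zn n → ℂ) : ℝ≥0∞ :=
  ⨆ (F : Zn n →₀ ℂ) (G : Zn n →₀ ℂ) (H : Zn n →₀ ℂ)
    (_ : ∑ μ ∈ F.support, ‖F μ‖ ^ 2 = 1)
    (_ : ∑ ν ∈ G.support, ‖G ν‖ ^ 2 = 1)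
    (_ : ∑ ρ ∈ H.support, ‖H ρ‖ ^ 2 = 1),
    (‖∑ μ ∈ F.support, ∑ ν ∈ G.support, A μ ν * F μ * G ν * H (μ + ν)‖₊ : ℝ≥0∞)

/-- The multiplier `σ_{A,Φ}(ξ,η) = Σ_{μ,ν} a_{μν} Φ(ξ-μ, η-ν)`. -/
def sigmaA {n : ℕ} (A : Zn n → Zn n → ℂ) (Φ : Rn n × Rn n → ℂ) (p : Rn n × Rn n) : ℂ :=
  ∑' μν : Zn n × Zn n, A μν.1 μν.2 * Φ (p.1 - coeZ μν.1, p.2 - coeZ μν.2)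

/-- Condition (A) for functions on `ℝ^d`. -/
def ConditionA {d : ℕ} (Φ : Rn d → ℂ) : Prop :=
  ∃ Θ : Rn d → ℂ, ContDiff ℝ (⊤ : ℕ∞) Θ ∧ HasCompactSupport Θ ∧
    ∀ α : Zn d, (∫ x : Rn d, Θ x * Φ (x - coeZ α)) = if α = 0 then 1 else 0

/-- Condition (A) for functions on `ℝ^n × ℝ^n` (i.e. `d = 2n`). -/
def ConditionA2 {n : ℕ} (Φ : Rn n × Rn n → ℂ) : Prop :=
  ∃ Θ : Rn n × Rn n → ℂ, ContDiff ℝ (⊤ : ℕ∞) Θ ∧ HasCompactSupport Θ ∧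
    ∀ α β : Zn n, (∫ p : Rn n × Rn n, Θ p * Φ (p.1 - coeZ α, p.2 - coeZ β)) =
      if α = 0 ∧ β = 0 then 1 else 0

/-- Condition (A) for functions on `ℝ` (the case `d = 1`). -/
def ConditionA1 (Φ : ℝ → ℂ) : Prop :=
  ∃ θ : ℝ → ℂ, ContDiff ℝ (⊤ : ℕ∞) θ ∧ HasCompactSupport θ ∧
    ∀ j : ℤ, (∫ x : ℝ, θ x * Φ (x - (j : ℝ))) = if j = 0 then 1 else 0

/-- The `L^∞` (sup) norm, valued in `ℝ≥0∞`. -/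
def supNorm {E : Type*} (u : E → ℂ) : ℝ≥0∞ := ⨆ x, (‖u x‖₊ : ℝ≥0∞)

end


/-- A smooth compactly supported function is the Fourier transform of a Schwartz function, with
the normalization given by Plancherel's theorem. -/
theorem exists_schwartz_ft_eq {n : ℕ} {u : Rn n → ℂ} (hu : IsCcInfty u)
    (h1 : ∫ ξ, ‖u ξ‖ ^ 2 = 1) :
    ∃ f : SchwartzMap (Rn n) ℂ, ft f = u ∧ eLpNorm (⇑f) 2 volume = 1 := by
  let e : EuclideanSpace ℝ (Fin n) ≃L[ℝ] Rn n := EuclideanSpace.equiv (Fin n) ℝ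
  have hmp : MeasurePreserving e := EuclideanSpace.volume_preserving_symm_measurableEquiv_toLp _
  have hme : MeasurableEmbedding e := e.toHomeomorph.measurableEmbedding
  let us : SchwartzMap (Rn n) ℂ := hu.2.toSchwartzMap hu.1
  let v : SchwartzMap (EuclideanSpace ℝ (Fin n)) ℂ :=
    SchwartzMap.compCLMOfContinuousLinearEquiv ℂ e us
  let w := FourierTransform.fourierInv v
  refine ⟨SchwartzMap.compCLMOfContinuousLinearEquiv ℂ e.symm w, ?_, ?_⟩
  · ext ξ
    have hv : FourierTransform.fourier w = v := by simp [w]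
    have h2 : FourierTransform.fourier (w : EuclideanSpace ℝ (Fin n) → ℂ) (e.symm ξ) = u ξ := by
      rw [← SchwartzMap.fourier_coe, hv]
      simp [v, us]
    rw [← h2, Real.fourier_eq', ft, ← hmp.integral_comp hme]
    congr 1
    ext x
    simp only [SchwartzMap.compCLMOfContinuousLinearEquiv_apply, Function.comp_apply,
      ContinuousLinearEquiv.symm_apply_apply, smul_eq_mul]
    congr 2
    simp only [PiLp.inner_apply, e, Finset.mul_sum, Finset.sum_mul, PiLp.continuousLinearEquiv_symm_apply,
      Complex.ofReal_sum, Complex.ofReal_mul]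
    refine Finset.sum_congr rfl fun i _ => ?_
    simp
    ring
  · have h2 : ∫ x, ‖w x‖ ^ 2 = 1 := by
      rw [← SchwartzMap.integral_norm_sq_fourier]
      have hv : FourierTransform.fourier w = v := by simp [w]
      rw [hv, ← h1, ← hmp.integral_comp hme]
      rfl
    have h3 : eLpNorm (⇑(SchwartzMap.compCLMOfContinuousLinearEquiv ℂ e.symm w)) 2 volume
        = eLpNorm (⇑w) 2 volume := by
      rw [← eLpNorm_comp_measurePreserving _ hmp]
      · rfl
      · exact (SchwartzMap.continuous _).aestronglyMeasurable
    rw [h3, (w.memLp 2 volume).eLpNorm_eq_integral_rpow_norm (by simp) (by simp)]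
    simp [h2]

theorem integral_cexp_int_Icc (k : ℤ) :
    ∫ t in Set.Icc (-1 / 2 : ℝ) (1 / 2), Complex.exp (2 * Real.pi * Complex.I * (t * k : ℝ)) =
      if k = 0 then 1 else 0 := by
  rw [integral_Icc_eq_integral_Ioc, ← intervalIntegral.integral_of_le (by norm_num)]
  split_ifs with hk
  · simp [hk]; norm_num
  · have hc : (2 * Real.pi * Complex.I * k : ℂ) ≠ 0 := by
      simp [hk, Real.pi_ne_zero]
    have h := integral_exp_mul_complex (a := -1 / 2) (b := 1 / 2) hc
    have h2 : ∀ t : ℝ, (2 * Real.pi * Complex.I * (t * k : ℝ) : ℂ) =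
        (2 * Real.pi * Complex.I * k : ℂ) * t := by intro t; push_cast; ring
    simp_rw [h2]
    rw [h, div_eq_zero_iff]
    left
    rw [sub_eq_zero, Complex.exp_eq_exp_iff_exists_int]
    exact ⟨k, by push_cast; ring⟩

theorem integral_cexp_cube {n : ℕ} (ρ : Zn n) :
    ∫ x in cube n 1, Complex.exp (2 * Real.pi * Complex.I * (∑ i, x i * coeZ ρ i : ℝ)) =
      if ρ = 0 then 1 else 0 := by
  rw [cube, volume_pi, Measure.restrict_pi_pi]
  have h : ∀ x : Rn n, Complex.exp (2 * Real.pi * Complex.I * (∑ i, x i * coeZ ρ i : ℝ)) =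
      ∏ i, Complex.exp (2 * Real.pi * Complex.I * (x i * ρ i : ℝ)) := by
    intro x
    rw [← Complex.exp_sum, Complex.ofReal_sum, Finset.mul_sum]
    rfl
  simp_rw [h]
  rw [integral_fintype_prod_eq_prod
    (f := fun i (t : ℝ) => Complex.exp (2 * Real.pi * Complex.I * (t * ρ i : ℝ)))]
  simp_rw [integral_cexp_int_Icc, Finset.prod_ite_zero]
  simp [funext_iff]

theorem isCompact_cube (n : ℕ) (a : ℝ) : IsCompact (cube n a) :=
  isCompact_univ_pi fun _ => isCompact_Icc

theorem integral_normSq_sum_cexp_cube {n : ℕ} (s : Finset (Zn n)) (c : Zn n → ℂ) :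
    ∫ x in cube n 1, ‖∑ ρ ∈ s,
      c ρ * Complex.exp (2 * Real.pi * Complex.I * (∑ i, x i * coeZ ρ i : ℝ))‖ ^ 2 =
      ∑ ρ ∈ s, ‖c ρ‖ ^ 2 := by
  have key : ∀ x : Rn n, ((‖∑ ρ ∈ s,
      c ρ * Complex.exp (2 * Real.pi * Complex.I * (∑ i, x i * coeZ ρ i : ℝ))‖ ^ 2 : ℝ) : ℂ) =
      ∑ ρ ∈ s, ∑ τ ∈ s, (starRingEnd ℂ (c ρ) * c τ) *
        Complex.exp (2 * Real.pi * Complex.I * (∑ i, x i * coeZ (τ - ρ) i : ℝ)) := by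
    intro x
    rw [Complex.ofReal_pow, ← Complex.conj_mul', map_sum, Finset.sum_mul_sum]
    refine Finset.sum_congr rfl fun ρ _ => Finset.sum_congr rfl fun τ _ => ?_
    rw [map_mul, ← Complex.exp_conj, mul_mul_mul_comm, ← Complex.exp_add]
    congr 2
    simp only [coeZ, Pi.sub_apply, map_mul, Complex.conj_ofReal, Complex.conj_I, map_ofNat,
      Int.cast_sub, mul_sub, Finset.sum_sub_distrib, Complex.ofReal_sub]
    ring
  apply Complex.ofReal_injective
  rw [← integral_complex_ofReal]
  simp_rw [key]
  have hint : ∀ (a : ℂ) (ρ : Zn n), Integrable (fun x : Rn n => a *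
      Complex.exp (2 * Real.pi * Complex.I * (∑ i, x i * coeZ ρ i : ℝ)))
      (volume.restrict (cube n 1)) := fun a ρ =>
    (Continuous.continuousOn (by fun_prop)).integrableOn_compact (isCompact_cube n 1)
  rw [integral_finsetSum _ fun ρ _ => integrable_finsetSum _ fun τ _ => hint _ _]
  simp_rw [integral_finsetSum s fun τ _ => hint _ _, integral_const_mul, integral_cexp_cube,
    sub_eq_zero]
  push_cast
  refine Finset.sum_congr rfl fun ρ hρ => ?_
  simp [hρ, Complex.conj_mul']

theorem cube_subset_cube {n : ℕ} {a b : ℝ} (h : a ≤ b) : cube n a ⊆ cube n b :=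
  Set.pi_mono fun _ _ => Set.Icc_subset_Icc (by linarith) (by linarith)

theorem eq_of_sub_coeZ_mem_cube {n : ℕ} {y : Rn n} {μ μ' : Zn n}
    (h : y - coeZ μ ∈ cube n (1 / 2)) (h' : y - coeZ μ' ∈ cube n 1) : μ = μ' := by
  ext i
  have h1 := h i trivial
  have h2 := h' i trivial
  simp only [coeZ, Pi.sub_apply, Set.mem_Icc] at h1 h2
  have h3 : |((μ i - μ' i : ℤ) : ℝ)| < 1 := by
    push_cast
    rw [abs_lt]
    constructor <;> linarith
  have h4 : |μ i - μ' i| < 1 := by exact_mod_cast h3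
  rw [Int.abs_lt_one_iff] at h4
  omega

theorem exists_normalized_bump (n : ℕ) {r : ℝ} (hr : 0 < r) :
    ∃ θ : Rn n → ℝ, ContDiff ℝ (⊤ : ℕ∞) θ ∧ HasCompactSupport θ ∧ (∀ ξ, 0 ≤ θ ξ) ∧
      Function.support θ ⊆ cube n r ∧ 0 < ∫ ξ, θ ξ ∧ ∫ ξ, θ ξ ^ 2 = 1 := by
  let b : ContDiffBump (0 : Rn n) := ⟨r / 4, r / 2, by positivity, by linarith⟩
  have hb : 0 < ∫ ξ, b ξ := b.integral_pos
  have hcont : Continuous b := b.continuous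
  have hb2 : 0 < ∫ ξ, b ξ ^ 2 := by
    refine (hcont.pow 2).integral_pos_of_hasCompactSupport_nonneg_nonzero
      (b.hasCompactSupport.comp_left (g := fun t : ℝ => t ^ 2) (by simp))
      (fun ξ => sq_nonneg _) (x := 0) ?_
    have : b (0 : Rn n) = 1 := b.one_of_mem_closedBall (by simp [b.rIn_pos.le])
    simp [this]
  set m := ∫ ξ, b ξ ^ 2 with hm
  have hs : 0 < (√m)⁻¹ := by positivity
  refine ⟨fun ξ => (√m)⁻¹ * b ξ, contDiff_const.mul b.contDiff, b.hasCompactSupport.mul_left,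
    fun ξ => mul_nonneg hs.le b.nonneg, ?_, ?_, ?_⟩
  · intro ξ hξ
    have h1 : ξ ∈ Function.support b := fun h => hξ (by simp [h])
    rw [b.support_eq, mem_ball_zero_iff] at h1
    intro i _
    have h2 : ‖ξ i‖ ≤ r / 2 := (norm_le_pi_norm ξ i).trans h1.le
    rw [Real.norm_eq_abs, abs_le] at h2
    exact ⟨by linarith [h2.1], h2.2⟩
  · rw [integral_const_mul]
    positivity
  · simp_rw [mul_pow]
    rw [integral_const_mul, ← hm, inv_pow, Real.sq_sqrt hb2.le, inv_mul_cancel₀ hb2.ne']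

theorem half_integral_le_norm_integral_cexp {n : ℕ} {θ : Rn n → ℝ} (hc : Continuous θ)
    (hcs : HasCompactSupport θ) (h0 : ∀ ξ, 0 ≤ θ ξ)
    (hs : Function.support θ ⊆ cube n (1 / (2 * (n + 1)))) {x : Rn n} (hx : x ∈ cube n 1) :
    (∫ ξ, θ ξ) / 2 ≤
      ‖∫ ξ, Complex.exp (2 * Real.pi * Complex.I * (∑ i, x i * ξ i : ℝ)) * θ ξ‖ := by
  refine le_trans ?_ (Complex.re_le_norm _)
  have hint : Integrable (fun ξ : Rn n =>
      Complex.exp (2 * Real.pi * Complex.I * (∑ i, x i * ξ i : ℝ)) * θ ξ) :=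
    Continuous.integrable_of_hasCompactSupport (by fun_prop)
      ((hcs.comp_left (g := Complex.ofReal) (by simp)).mul_left)
  have hre := integral_re hint
  simp only [RCLike.re_eq_complex_re] at hre
  rw [← hre, div_eq_mul_inv, ← integral_mul_const]
  refine integral_mono ((hc.integrable_of_hasCompactSupport hcs).mul_const _) hint.re fun ξ => ?_
  have hexp : (Complex.exp (2 * Real.pi * Complex.I * (∑ i, x i * ξ i : ℝ)) * θ ξ).re =
      Real.cos (2 * Real.pi * ∑ i, x i * ξ i) * θ ξ := by
    rw [Complex.re_mul_ofReal]
    congr 1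
    rw [show (2 * Real.pi * Complex.I * (∑ i, x i * ξ i : ℝ) : ℂ) =
      ((2 * Real.pi * ∑ i, x i * ξ i : ℝ) : ℂ) * Complex.I by push_cast; ring]
    exact Complex.exp_ofReal_mul_I_re _
  simp only [hexp]
  by_cases hξ : θ ξ = 0
  · simp [hξ]
  rw [mul_comm]
  refine mul_le_mul_of_nonneg_right ?_ (h0 ξ)
  have hξ' := hs hξ
  have hn : (0 : ℝ) < n + 1 := by positivity
  have hsum : |∑ i, x i * ξ i| ≤ 1 / 8 := by
    calc |∑ i, x i * ξ i| ≤ ∑ i, |x i * ξ i| := Finset.abs_sum_le_sum_abs _ _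
      _ ≤ ∑ _i : Fin n, (1 / 2 * (1 / (2 * (n + 1)) / 2) : ℝ) := by
        refine Finset.sum_le_sum fun i _ => ?_
        have h1 := hx i trivial
        have h2 := hξ' i trivial
        rw [abs_mul]
        refine mul_le_mul (abs_le.2 ⟨by linarith [h1.1], by linarith [h1.2]⟩)
          (abs_le.2 ⟨by linarith [h2.1], by linarith [h2.2]⟩) (abs_nonneg _) (by norm_num)
      _ ≤ 1 / 8 := by
        simp only [Finset.sum_const, Finset.card_univ, Fintype.card_fin, nsmul_eq_mul]
        field_simp
        linarith
  rw [← Real.cos_abs, ← one_div, ← Real.cos_pi_div_three]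
  have hpi := Real.pi_pos
  refine Real.cos_le_cos_of_nonneg_of_le_pi (abs_nonneg _) (by linarith) ?_
  rw [abs_mul, abs_of_pos (by positivity)]
  nlinarith

theorem sigmaA_eq_of_mem_cube {n : ℕ} {φ : Rn n → ℂ} (hsupp : Function.support φ ⊆ cube n 1)
    (hone : ∀ ξ ∈ cube n (1 / 2), φ ξ = 1) (A : Zn n → Zn n → ℂ) {p : Rn n × Rn n}
    {μ ν : Zn n} (hμ : p.1 - coeZ μ ∈ cube n (1 / 2)) (hν : p.2 - coeZ ν ∈ cube n (1 / 2)) :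
    sigmaA A (fun p : Rn n × Rn n => φ p.1 * φ p.2) p = A μ ν := by
  rw [sigmaA, tsum_eq_single (μ, ν)]
  · simp [hone _ hμ, hone _ hν]
  · rintro ⟨μ', ν'⟩ hne
    by_contra hz
    simp only [mul_eq_zero, not_or] at hz
    exact hne (Prod.ext (eq_of_sub_coeZ_mem_cube hμ (hsupp hz.2.1)).symm
      (eq_of_sub_coeZ_mem_cube hν (hsupp hz.2.2)).symm)

theorem norm_sum_translates_sq {n : ℕ} {θ : Rn n → ℝ}
    (hs : Function.support θ ⊆ cube n (1 / 2)) (s : Finset (Zn n)) (F : Zn n → ℂ) (ξ : Rn n) :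
    ‖∑ μ ∈ s, F μ * θ (ξ - coeZ μ)‖ ^ 2 = ∑ μ ∈ s, ‖F μ‖ ^ 2 * θ (ξ - coeZ μ) ^ 2 := by
  by_cases h : ∃ μ ∈ s, θ (ξ - coeZ μ) ≠ 0
  · obtain ⟨μ, hμ, hne⟩ := h
    have hz : ∀ μ' ∈ s, μ' ≠ μ → θ (ξ - coeZ μ') = 0 := fun μ' _ hμ' => by
      by_contra hne'
      exact hμ' (eq_of_sub_coeZ_mem_cube (hs hne')
        (cube_subset_cube (by norm_num) (hs hne)))
    rw [Finset.sum_eq_single_of_mem μ hμ fun μ' h1 h2 => by simp [hz μ' h1 h2],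
      Finset.sum_eq_single_of_mem μ hμ fun μ' h1 h2 => by simp [hz μ' h1 h2]]
    simp [mul_pow]
  · push Not at h
    rw [Finset.sum_eq_zero fun μ hμ => by simp [h μ hμ],
      Finset.sum_eq_zero fun μ hμ => by simp [h μ hμ]]
    simp

theorem exists_schwartz_ft_eq_sum_translates {n : ℕ} {θ : Rn n → ℝ}
    (hθ : ContDiff ℝ (⊤ : ℕ∞) θ) (hcs : HasCompactSupport θ)
    (hs : Function.support θ ⊆ cube n (1 / 2)) (h1 : ∫ ξ, θ ξ ^ 2 = 1)
    (s : Finset (Zn n)) (F : Zn n → ℂ) (hF : ∑ μ ∈ s, ‖F μ‖ ^ 2 = 1) :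
    ∃ f : SchwartzMap (Rn n) ℂ, (ft f = fun ξ => ∑ μ ∈ s, F μ * θ (ξ - coeZ μ)) ∧
      eLpNorm (⇑f) 2 volume = 1 := by
  have hcs' : ∀ μ : Zn n, HasCompactSupport fun ξ => θ (ξ - coeZ μ) := fun μ =>
    hcs.comp_homeomorph (Homeomorph.subRight (coeZ μ))
  have hdiff : ∀ μ : Zn n, ContDiff ℝ (⊤ : ℕ∞) fun ξ => θ (ξ - coeZ μ) := fun μ =>
    hθ.comp (contDiff_id.sub contDiff_const)
  refine exists_schwartz_ft_eq ⟨?_, ?_⟩ ?_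
  · exact ContDiff.sum fun μ _ => contDiff_const.mul (Complex.ofRealCLM.contDiff.comp (hdiff μ))
  · have : ∀ t : Finset (Zn n), HasCompactSupport fun ξ => ∑ μ ∈ t, F μ * θ (ξ - coeZ μ) := by
      intro t
      induction t using Finset.cons_induction with
      | empty => simpa using! HasCompactSupport.zero
      | cons a t ha ih =>
        simp_rw [Finset.sum_cons]
        exact HasCompactSupport.add
          (((hcs' a).comp_left (g := Complex.ofReal) (by simp)).mul_left) ih
    exact this s
  · have hint : ∀ μ : Zn n, Integrable fun ξ => ‖F μ‖ ^ 2 * θ (ξ - coeZ μ) ^ 2 := fun μ => by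
      refine Integrable.const_mul (Continuous.integrable_of_hasCompactSupport
        ((hdiff μ).continuous.pow 2) ?_) _
      simp_rw [sq]
      exact (hcs' μ).mul_left
    rw [funext (norm_sum_translates_sq hs s F), integral_finsetSum _ fun μ _ => hint μ, ← hF]
    refine Finset.sum_congr rfl fun μ _ => ?_
    rw [integral_const_mul, integral_sub_right_eq_self (fun ξ => θ ξ ^ 2), h1, mul_one]

theorem integral_cexp_mul_translate {n : ℕ} (θ : Rn n → ℝ) (x : Rn n) (μ : Zn n) :
    ∫ ξ, Complex.exp (2 * Real.pi * Complex.I * (∑ i, x i * ξ i : ℝ)) * θ (ξ - coeZ μ) =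
      Complex.exp (2 * Real.pi * Complex.I * (∑ i, x i * coeZ μ i : ℝ)) *
        ∫ ξ, Complex.exp (2 * Real.pi * Complex.I * (∑ i, x i * ξ i : ℝ)) * θ ξ := by
  rw [← integral_add_right_eq_self _ (coeZ μ), ← integral_const_mul]
  congr 1
  ext ξ
  rw [add_sub_cancel_right, ← mul_assoc, ← Complex.exp_add]
  congr 2
  simp only [Pi.add_apply, mul_add, Finset.sum_add_distrib, Complex.ofReal_add]
  ring

theorem Tbil_sigmaA_eq {n : ℕ} {φ : Rn n → ℂ} (hsupp : Function.support φ ⊆ cube n 1)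
    (hone : ∀ ξ ∈ cube n (1 / 2), φ ξ = 1) {θ : Rn n → ℝ} (hc : Continuous θ)
    (hcs : HasCompactSupport θ) (hs : Function.support θ ⊆ cube n (1 / 2))
    (A : Zn n → Zn n → ℂ) (s t : Finset (Zn n)) (F G : Zn n → ℂ) (f g : SchwartzMap (Rn n) ℂ)
    (hf : ft f = fun ξ => ∑ μ ∈ s, F μ * θ (ξ - coeZ μ))
    (hg : ft g = fun ξ => ∑ ν ∈ t, G ν * θ (ξ - coeZ ν)) (x : Rn n) :
    Tbil (sigmaA A fun p : Rn n × Rn n => φ p.1 * φ p.2) f g x =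
      (∑ p ∈ s ×ˢ t, A p.1 p.2 * F p.1 * G p.2 *
        Complex.exp (2 * Real.pi * Complex.I * (∑ i, x i * coeZ (p.1 + p.2) i : ℝ))) *
      (∫ ξ, Complex.exp (2 * Real.pi * Complex.I * (∑ i, x i * ξ i : ℝ)) * θ ξ) ^ 2 := by
  set E : Rn n → ℂ := fun ξ => Complex.exp (2 * Real.pi * Complex.I * (∑ i, x i * ξ i : ℝ)) with hE
  have hEadd : ∀ ξ η, E (ξ + η) = E ξ * E η := fun ξ η => by
    simp only [hE]
    rw [← Complex.exp_add]
    congr 1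
    simp only [Pi.add_apply, mul_add, Finset.sum_add_distrib, Complex.ofReal_add]
  have hint : ∀ μ : Zn n, Integrable fun ξ => E ξ * θ (ξ - coeZ μ) := fun μ => by
    refine Continuous.integrable_of_hasCompactSupport (by fun_prop) (HasCompactSupport.mul_left ?_)
    exact (hcs.comp_homeomorph (Homeomorph.subRight (coeZ μ))).comp_left
      (g := Complex.ofReal) (by simp)
  have hpt : ∀ p : Rn n × Rn n, E (p.1 + p.2) *
      sigmaA A (fun p : Rn n × Rn n => φ p.1 * φ p.2) p * ft f p.1 * ft g p.2 =
      ∑ q ∈ s ×ˢ t, (A q.1 q.2 * F q.1 * G q.2) *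
        ((E p.1 * θ (p.1 - coeZ q.1)) * (E p.2 * θ (p.2 - coeZ q.2))) := fun p => by
    rw [mul_assoc, hf, hg, Finset.sum_mul_sum, ← Finset.sum_product', Finset.mul_sum]
    refine Finset.sum_congr rfl fun q _ => ?_
    by_cases h1 : θ (p.1 - coeZ q.1) = 0
    · simp [h1]
    by_cases h2 : θ (p.2 - coeZ q.2) = 0
    · simp [h2]
    rw [sigmaA_eq_of_mem_cube hsupp hone A (hs h1) (hs h2), hEadd]
    ring
  have hT : Tbil (sigmaA A fun p : Rn n × Rn n => φ p.1 * φ p.2) f g x = ∫ p : Rn n × Rn n,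
      E (p.1 + p.2) * sigmaA A (fun p : Rn n × Rn n => φ p.1 * φ p.2) p * ft f p.1 * ft g p.2 :=
    rfl
  rw [hT]
  simp_rw [hpt]
  rw [Measure.volume_eq_prod, integral_finsetSum _ fun q _ =>
    ((hint q.1).mul_prod (hint q.2)).const_mul _, Finset.sum_mul]
  refine Finset.sum_congr rfl fun q _ => ?_
  rw [integral_const_mul, integral_prod_mul (fun ξ => E ξ * θ (ξ - coeZ q.1))
    (fun ξ => E ξ * θ (ξ - coeZ q.2)), integral_cexp_mul_translate, integral_cexp_mul_translate]
  have : coeZ (q.1 + q.2) = coeZ q.1 + coeZ q.2 := by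
    ext i
    simp [coeZ]
  rw [this, show Complex.exp (2 * Real.pi * Complex.I *
    (∑ i, x i * (coeZ q.1 + coeZ q.2) i : ℝ)) = _ from hEadd (coeZ q.1) (coeZ q.2)]
  ring

theorem norm_sum_mul_add_sq_le {n : ℕ} (S : Finset (Zn n × Zn n)) (a : Zn n × Zn n → ℂ)
    (H : Zn n →₀ ℂ) (hH : ∑ ρ ∈ H.support, ‖H ρ‖ ^ 2 = 1) :
    ‖∑ p ∈ S, a p * H (p.1 + p.2)‖ ^ 2 ≤ ∫ x in cube n 1, ‖∑ p ∈ S,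
      a p * Complex.exp (2 * Real.pi * Complex.I * (∑ i, x i * coeZ (p.1 + p.2) i : ℝ))‖ ^ 2 := by
  classical
  set R := S.image fun p => p.1 + p.2 with hR
  have hmaps : ∀ p ∈ S, p.1 + p.2 ∈ R := fun p hp => Finset.mem_image_of_mem _ hp
  set c : Zn n → ℂ := fun ρ => ∑ p ∈ S with p.1 + p.2 = ρ, a p with hc
  have hsum : ∀ e : Zn n → ℂ, ∑ p ∈ S, a p * e (p.1 + p.2) = ∑ ρ ∈ R, c ρ * e ρ := fun e => by
    rw [← Finset.sum_fiberwise_of_maps_to hmaps]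
    refine Finset.sum_congr rfl fun ρ _ => ?_
    rw [hc, Finset.sum_mul]
    refine Finset.sum_congr rfl fun p hp => ?_
    rw [(Finset.mem_filter.1 hp).2]
  have hHR : ∑ ρ ∈ R, ‖H ρ‖ ^ 2 ≤ 1 := by
    rw [← hH]
    refine (Finset.sum_subset_zero_on_sdiff (s₁ := R ∩ H.support) Finset.inter_subset_left
      (fun ρ hρ => ?_) fun _ _ => rfl).symm.le.trans
      (Finset.sum_le_sum_of_subset_of_nonneg Finset.inter_subset_right
        fun _ _ _ => sq_nonneg _)
    simp only [Finset.mem_sdiff, Finset.mem_inter, Finsupp.mem_support_iff] at hρ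
    have : H ρ = 0 := by tauto
    simp [this]
  simp_rw [fun x : Rn n => hsum fun ρ =>
    Complex.exp (2 * Real.pi * Complex.I * (∑ i, x i * coeZ ρ i : ℝ))]
  rw [integral_normSq_sum_cexp_cube, hsum]
  calc ‖∑ ρ ∈ R, c ρ * H ρ‖ ^ 2 ≤ (∑ ρ ∈ R, ‖c ρ‖ * ‖H ρ‖) ^ 2 := by
        gcongr
        exact (norm_sum_le _ _).trans_eq (by simp)
    _ ≤ (∑ ρ ∈ R, ‖c ρ‖ ^ 2) * ∑ ρ ∈ R, ‖H ρ‖ ^ 2 := Finset.sum_mul_sq_le_sq_mul_sq _ _ _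
    _ ≤ ∑ ρ ∈ R, ‖c ρ‖ ^ 2 :=
        mul_le_of_le_one_right (Finset.sum_nonneg fun _ _ => sq_nonneg _) hHR

theorem ofReal_mul_le_localL2_zero {n : ℕ} {P w : Rn n → ℂ} (hP : Continuous P) {k b : ℝ}
    (hk : 0 ≤ k) (hb : 0 ≤ b) (hw : ∀ x ∈ cube n 1, k ≤ ‖w x‖)
    (hle : b ^ 2 ≤ ∫ x in cube n 1, ‖P x‖ ^ 2) :
    ENNReal.ofReal (k ^ 2 * b) ≤ localL2 (fun x => P x * w x ^ 2) 0 := by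
  have hz : ∀ x : Rn n, x + coeZ 0 = x := fun x => by
    ext i
    simp [coeZ]
  have hint : Integrable (fun x => (k ^ 2) ^ 2 * ‖P x‖ ^ 2) (volume.restrict (cube n 1)) :=
    (Continuous.continuousOn (by fun_prop)).integrableOn_compact (isCompact_cube n 1)
  have hmeas : MeasurableSet (cube n 1) := (isCompact_cube n 1).measurableSet
  have key : ENNReal.ofReal ((k ^ 2 * b) ^ 2) ≤
      ∫⁻ x in cube n 1, (‖P (x + coeZ 0) * w (x + coeZ 0) ^ 2‖₊ : ℝ≥0∞) ^ 2 := by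
    calc ENNReal.ofReal ((k ^ 2 * b) ^ 2)
        ≤ ENNReal.ofReal (∫ x in cube n 1, (k ^ 2) ^ 2 * ‖P x‖ ^ 2) := by
          rw [integral_const_mul, mul_pow]
          gcongr
      _ = ∫⁻ x in cube n 1, ENNReal.ofReal ((k ^ 2) ^ 2 * ‖P x‖ ^ 2) :=
          ofReal_integral_eq_lintegral_ofReal hint (ae_of_all _ fun x => by positivity)
      _ ≤ _ := by
          refine setLIntegral_mono' hmeas fun x hx => ?_
          rw [hz, ← enorm_eq_nnnorm, ← ofReal_norm, ← ENNReal.ofReal_pow (norm_nonneg _)]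
          refine ENNReal.ofReal_le_ofReal ?_
          rw [norm_mul, norm_pow, mul_pow, mul_comm]
          have := hw x hx
          gcongr
  rw [localL2]
  calc ENNReal.ofReal (k ^ 2 * b) = ENNReal.ofReal ((k ^ 2 * b) ^ 2) ^ (1 / 2 : ℝ) := by
        rw [ENNReal.ofReal_pow (by positivity), ← ENNReal.rpow_natCast, ← ENNReal.rpow_mul]
        norm_num
    _ ≤ _ := ENNReal.rpow_le_rpow key (by norm_num)

/-- lower bound for the special product bump `Φ(ξ,η) = φ(ξ)φ(η)` with
`supp φ ⊂ Q` and `φ = 1` on `2⁻¹Q`. -/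
theorem statement9 (n : ℕ) (φ : Rn n → ℂ) (hφ : IsCcInfty φ)
    (hsupp : Function.support φ ⊆ cube n 1) (hone : ∀ ξ ∈ cube n (1 / 2), φ ξ = 1) :
    ∃ c : ℝ≥0∞, 0 < c ∧ c < ∞ ∧
      ∀ A : Zn n → Zn n → ℂ, IsLinftyMatrix A →
        c⁻¹ * normB A ≤ multNorm ⊤ (sigmaA A (fun p : Rn n × Rn n => φ p.1 * φ p.2)) := by
  obtain ⟨θ, hθ, hcs, hθ0, hs, hpos, hsq⟩ :=
    exists_normalized_bump n (r := 1 / (2 * (n + 1))) (by positivity)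
  have hs' : Function.support θ ⊆ cube n (1 / 2) := hs.trans <| cube_subset_cube <| by
    apply one_div_le_one_div_of_le <;> norm_num
  set k := (∫ ξ, θ ξ) / 2 with hk
  have hk0 : 0 < k := by positivity
  have hk2 : 0 < ENNReal.ofReal (k ^ 2) := ENNReal.ofReal_pos.2 (by positivity)
  refine ⟨(ENNReal.ofReal (k ^ 2))⁻¹, by simp, ENNReal.inv_lt_top.2 hk2, fun A _ => ?_⟩
  rw [inv_inv, normB]
  simp_rw [ENNReal.mul_iSup]
  refine iSup_le fun F => iSup_le fun G => iSup_le fun H => iSup_le fun hF => iSup_le fun hG =>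
    iSup_le fun hH => ?_
  obtain ⟨f, hf, hf1⟩ := exists_schwartz_ft_eq_sum_translates hθ hcs hs' hsq F.support F hF
  obtain ⟨g, hg, hg1⟩ := exists_schwartz_ft_eq_sum_translates hθ hcs hs' hsq G.support G hG
  refine le_trans ?_ (le_iSup₂_of_le f g (le_iSup₂_of_le hf1 hg1 le_rfl))
  rw [amalgamNorm, if_pos rfl]
  refine le_trans ?_ (le_iSup _ (0 : Zn n))
  rw [funext (Tbil_sigmaA_eq hsupp hone hθ.continuous hcs hs' A _ _ F G f g hf hg)]
  rw [← Finset.sum_product' (f := fun μ ν => A μ ν * F μ * G ν * H (μ + ν)), ← enorm_eq_nnnorm,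
    ← ofReal_norm, ← ENNReal.ofReal_mul (by positivity)]
  exact ofReal_mul_le_localL2_zero (by fun_prop) hk0.le (norm_nonneg _)
    (fun x hx => half_integral_le_norm_integral_cexp hθ.continuous hcs hθ0 hs hx)
    (norm_sum_mul_add_sq_le _ (fun p => A p.1 p.2 * F p.1 * G p.2) H hH)
end

section
/- Let σ_{μν} ∈ L^∞(ℝ^n × ℝ^n) be given for each (μ,ν) ∈ ℤ^n × ℤ^n and assume: (i) sup_{μ,ν} ‖σ_{μν}‖_{L^∞} < ∞; (ii) there exists K ∈ (0,∞) such that supp σ_{μν} ⊂ (μ,ν) + KQ × KQ for all μ, ν; (iii) there exists M ∈ [0,∞) such that ‖Σ_{μ,ν∈ℤ^n} α_μ α′_ν σ_{μν}‖_{M(L²×L² → (L²,ℓ^∞))} ≤ M for all choices of α_μ ∈ {0,1} and α′_ν ∈ {0,1}. Let u, v ∈ C_c^∞(ℝ^n) with supp u ⊂ TQ and supp v ⊂ TQ for some T > 0. Then there exists a constant c_{n,K,T}, depending only on n, K, T, such that ‖Σ_{μ,ν∈ℤ^n} u(ξ−μ) v(η−ν) σ_{μν}(ξ,η)‖_{M(L²×L²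 → (L²,ℓ^∞))} ≤ c_{n,K,T} ‖u‖_{L^∞} ‖v‖_{L^∞} M. -/
open MeasureTheory Complex
open scoped ENNReal NNReal

open scoped FourierTransform

/-- The Fourier transform on Schwartz functions on `Fin n → ℝ`, transported from
`EuclideanSpace ℝ (Fin n)`. -/
noncomputable def schwartzFt {n : ℕ} (f : SchwartzMap (Rn n) ℂ) : SchwartzMap (Rn n) ℂ :=
  SchwartzMap.compCLMOfContinuousLinearEquiv ℂ (EuclideanSpace.equiv (Fin n) ℝ).symm
    (𝓕 (SchwartzMap.compCLMOfContinuousLinearEquiv ℂ (EuclideanSpace.equiv (Fin n) ℝ) f))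

/-- The inverse of `schwartzFt`. -/
noncomputable def schwartzFtInv {n : ℕ} (f : SchwartzMap (Rn n) ℂ) : SchwartzMap (Rn n) ℂ :=
  SchwartzMap.compCLMOfContinuousLinearEquiv ℂ (EuclideanSpace.equiv (Fin n) ℝ).symm
    (𝓕⁻ (SchwartzMap.compCLMOfContinuousLinearEquiv ℂ (EuclideanSpace.equiv (Fin n) ℝ) f))

theorem schwartzFt_schwartzFtInv {n : ℕ} (f : SchwartzMap (Rn n) ℂ) :
    schwartzFt (schwartzFtInv f) = f := by
  have h : SchwartzMap.compCLMOfContinuousLinearEquiv ℂ (EuclideanSpace.equiv (Fin n) ℝ)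
      (schwartzFtInv f) =
      𝓕⁻ (SchwartzMap.compCLMOfContinuousLinearEquiv ℂ (EuclideanSpace.equiv (Fin n) ℝ) f) := by
    ext x
    simp [schwartzFtInv]
  ext x
  rw [schwartzFt, h, FourierTransform.fourier_fourierInv_eq]
  rfl

theorem ft_eq_schwartzFt {n : ℕ} (f : SchwartzMap (Rn n) ℂ) (ξ : Rn n) :
    ft f ξ = schwartzFt f ξ := by
  simp only [schwartzFt, SchwartzMap.compCLMOfContinuousLinearEquiv_apply, Function.comp_apply,
    SchwartzMap.fourier_coe, Real.fourier_eq', ft]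
  rw [← (PiLp.volume_preserving_ofLp (Fin n)).integral_comp
    (MeasurableEquiv.toLp 2 (Fin n → ℝ)).symm.measurableEmbedding]
  refine integral_congr_ae (.of_forall fun x => ?_)
  simp only [smul_eq_mul, PiLp.inner_apply]
  congr 2
  push_cast
  simp [mul_comm]
  ring

theorem eLpNorm_comp_equiv {n : ℕ} (f : SchwartzMap (Rn n) ℂ) :
    eLpNorm (SchwartzMap.compCLMOfContinuousLinearEquiv ℂ (EuclideanSpace.equiv (Fin n) ℝ) f) 2
      volume = eLpNorm f 2 volume :=
  eLpNorm_comp_measurePreserving f.continuous.aestronglyMeasurable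
    (PiLp.volume_preserving_ofLp (Fin n))

theorem eLpNorm_comp_equiv_symm {n : ℕ} (f : SchwartzMap (EuclideanSpace ℝ (Fin n)) ℂ) :
    eLpNorm (SchwartzMap.compCLMOfContinuousLinearEquiv ℂ (EuclideanSpace.equiv (Fin n) ℝ).symm f) 2
      volume = eLpNorm f 2 volume :=
  eLpNorm_comp_measurePreserving f.continuous.aestronglyMeasurable
    (PiLp.volume_preserving_toLp (Fin n))

theorem eLpNorm_fourier_eq {n : ℕ} (f : SchwartzMap (EuclideanSpace ℝ (Fin n)) ℂ) :
    eLpNorm (𝓕 f : SchwartzMap (EuclideanSpace ℝ (Fin n)) ℂ) 2 volume = eLpNorm f 2 volume := by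
  have h := SchwartzMap.norm_fourier_toL2_eq f
  rw [SchwartzMap.norm_toLp, SchwartzMap.norm_toLp] at h
  have h₁ := (SchwartzMap.memLp (𝓕 f) 2 volume).eLpNorm_ne_top
  have h₂ := (SchwartzMap.memLp f 2 volume).eLpNorm_ne_top
  exact (ENNReal.toReal_eq_toReal_iff' h₁ h₂).1 h

/-- Plancherel's theorem. -/
theorem eLpNorm_schwartzFt {n : ℕ} (f : SchwartzMap (Rn n) ℂ) :
    eLpNorm (schwartzFt f) 2 volume = eLpNorm f 2 volume := by
  rw [← eLpNorm_comp_equiv f]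
  exact (eLpNorm_comp_equiv_symm _).trans (eLpNorm_fourier_eq _)

/-- Linear Fourier multipliers of temperate growth preserve the Schwartz space, with the expected
`L²` bound. -/
theorem exists_ft_eq_mul {n : ℕ} {U : Rn n → ℂ} (hU : U.HasTemperateGrowth) {B : ℝ≥0}
    (hB : ∀ ξ, ‖U ξ‖₊ ≤ B) (f : SchwartzMap (Rn n) ℂ) :
    ∃ f' : SchwartzMap (Rn n) ℂ, (∀ ξ, ft f' ξ = U ξ * ft f ξ) ∧
      eLpNorm f' 2 volume ≤ B * eLpNorm f 2 volume := by
  have h (ξ : Rn n) : schwartzFt (schwartzFtInv (SchwartzMap.smulLeftCLM ℂ U (schwartzFt f))) ξ =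
      U ξ * schwartzFt f ξ := by
    rw [schwartzFt_schwartzFtInv, SchwartzMap.smulLeftCLM_apply_apply hU, smul_eq_mul]
  refine ⟨schwartzFtInv (SchwartzMap.smulLeftCLM ℂ U (schwartzFt f)), fun ξ => ?_, ?_⟩
  · rw [ft_eq_schwartzFt, ft_eq_schwartzFt, h]
  · rw [← eLpNorm_schwartzFt, ← eLpNorm_schwartzFt f]
    refine eLpNorm_le_nnreal_smul_eLpNorm_of_ae_le_mul (.of_forall fun ξ => ?_) 2
    rw [h, nnnorm_mul]
    gcongr
    exact hB ξ

theorem integrable_ft {n : ℕ} (f : SchwartzMap (Rn n) ℂ) : Integrable (ft f) := by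
  rw [funext (ft_eq_schwartzFt f)]
  exact SchwartzMap.integrable _

/-- The indicator, on `ℤ^n`, of a residue class modulo `N`. -/
noncomputable def classInd {n : ℕ} (N : ℕ) (r : Fin n → ZMod N) (μ : Zn n) : ℂ :=
  if (fun i => (μ i : ZMod N)) = r then 1 else 0

theorem classInd_eq_zero_or_one {n : ℕ} (N : ℕ) (r : Fin n → ZMod N) (μ : Zn n) :
    classInd N r μ = 0 ∨ classInd N r μ = 1 := by
  unfold classInd
  split_ifs <;> simp

theorem sum_classInd {n : ℕ} (N : ℕ) [NeZero N] (μ : Zn n) :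
    ∑ r : Fin n → ZMod N, classInd N r μ = 1 := by
  simp [classInd]

theorem eq_of_classInd_ne_zero {n N : ℕ} {r : Fin n → ZMod N} {μ μ' : Zn n}
    (h : classInd N r μ ≠ 0) (h' : classInd N r μ' ≠ 0) {a b d : ℝ} (hN : (a + b) / 2 + d < N)
    {ξ ξ' : Rn n} (hd : ∀ i, |ξ i - ξ' i| ≤ d)
    (hξ : ξ - coeZ μ ∈ cube n a) (hξ' : ξ' - coeZ μ' ∈ cube n b) : μ = μ' := by
  simp only [classInd, ne_eq, ite_eq_right_iff, one_ne_zero, imp_false, not_not] at h h'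
  ext i
  have hi : (μ i : ZMod N) = (μ' i : ZMod N) := congrFun (h.trans h'.symm) i
  have hdvd : (N : ℤ) ∣ μ' i - μ i := (ZMod.intCast_eq_intCast_iff_dvd_sub _ _ _).1 hi
  have h1 := hξ i trivial
  have h2 := hξ' i trivial
  have h3 := abs_le.1 (hd i)
  simp only [Pi.sub_apply, coeZ, Set.mem_Icc] at h1 h2
  have h4 : |((μ' i - μ i : ℤ) : ℝ)| < N := by
    push_cast
    rw [abs_lt]
    constructor <;> linarith
  have h5 : |μ' i - μ i| < (N : ℤ) := by exact_mod_cast h4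
  have := Int.eq_zero_of_abs_lt_dvd hdvd h5
  lia

/-- The sum of the translates of `u` along a residue class of `ℤ^n` modulo `N`. -/
noncomputable def classPeriodization {n : ℕ} (N : ℕ) (r : Fin n → ZMod N) (u : Rn n → ℂ)
    (ξ : Rn n) : ℂ :=
  ∑' μ : Zn n, classInd N r μ * u (ξ - coeZ μ)

theorem classPeriodization_eq {n N : ℕ} {r : Fin n → ZMod N} {u : Rn n → ℂ} {μ : Zn n}
    (hμ : classInd N r μ ≠ 0) {ξ : Rn n}
    (h : ∀ μ', classInd N r μ' ≠ 0 → u (ξ - coeZ μ') ≠ 0 → μ' = μ) :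
    classPeriodization N r u ξ = u (ξ - coeZ μ) := by
  rw [classPeriodization, tsum_eq_single μ]
  · rw [(classInd_eq_zero_or_one N r μ).resolve_left hμ, one_mul]
  · intro μ' hne
    by_contra h0
    exact hne (h μ' (left_ne_zero_of_mul h0) (right_ne_zero_of_mul h0))

theorem classPeriodization_eventuallyEq {n N : ℕ} (r : Fin n → ZMod N) {u : Rn n → ℂ} {T : ℝ}
    (hN : T + 1 < N) (hu : Function.support u ⊆ cube n T) (ξ₀ : Rn n) :
    classPeriodization N r u =ᶠ[nhds ξ₀] 0 ∨
      ∃ μ : Zn n, classPeriodization N r u =ᶠ[nhds ξ₀] fun ξ => u (ξ - coeZ μ) := by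
  by_cases h : ∃ ξ ∈ Metric.ball ξ₀ (1 / 2), ∃ μ, classInd N r μ ≠ 0 ∧ u (ξ - coeZ μ) ≠ 0
  · obtain ⟨ξ₁, hξ₁, μ, hμ, hne⟩ := h
    refine .inr ⟨μ, ?_⟩
    filter_upwards [Metric.ball_mem_nhds ξ₀ (by norm_num : (0 : ℝ) < 1 / 2)] with ξ hξ
    refine classPeriodization_eq hμ fun μ' hμ' hne' => ?_
    refine eq_of_classInd_ne_zero hμ' hμ (d := 1) (by linarith) (fun i => ?_) (hu hne') (hu hne)
    have h1 := (dist_le_pi_dist ξ ξ₁ i).trans (dist_triangle_right ξ ξ₁ ξ₀)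
    rw [Real.dist_eq] at h1
    have h2 := Metric.mem_ball.1 hξ
    have h3 := Metric.mem_ball.1 hξ₁
    linarith
  · push Not at h
    refine .inl ?_
    filter_upwards [Metric.ball_mem_nhds ξ₀ (by norm_num : (0 : ℝ) < 1 / 2)] with ξ hξ
    refine (tsum_congr fun μ => ?_).trans tsum_zero
    by_cases hμ : classInd N r μ = 0
    · simp [hμ]
    · simp [h ξ hξ μ hμ]

theorem classPeriodization_hasTemperateGrowth {n N : ℕ} (r : Fin n → ZMod N) {u : Rn n → ℂ} {T : ℝ}
    (hN : T + 1 < N) (hu : Function.support u ⊆ cube n T) (hc : IsCcInfty u) :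
    (classPeriodization N r u).HasTemperateGrowth := by
  refine ⟨contDiff_iff_contDiffAt.2 fun ξ => ?_, fun k => ?_⟩
  · obtain h | ⟨μ, h⟩ := classPeriodization_eventuallyEq r hN hu ξ
    · exact (contDiffAt_const (c := (0 : ℂ))).congr_of_eventuallyEq h
    · exact (hc.1.comp (contDiff_id.sub contDiff_const)).contDiffAt.congr_of_eventuallyEq h
  · obtain ⟨C, hC⟩ := (hc.1.continuous_iteratedFDeriv (m := k)
      (mod_cast le_top)).bounded_above_of_compact_support (hc.2.iteratedFDeriv k)
    refine ⟨0, C, fun ξ => ?_⟩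
    rw [pow_zero, mul_one]
    obtain h | ⟨μ, h⟩ := classPeriodization_eventuallyEq r hN hu ξ
    · rw [(h.iteratedFDeriv ℝ k).eq_of_nhds, iteratedFDeriv_zero]
      simpa using (norm_nonneg _).trans (hC ξ)
    · rw [(h.iteratedFDeriv ℝ k).eq_of_nhds, iteratedFDeriv_comp_sub]
      exact hC _

theorem nnnorm_classPeriodization_le {n N : ℕ} (r : Fin n → ZMod N) {u : Rn n → ℂ} {T : ℝ}
    (hN : T + 1 < N) (hu : Function.support u ⊆ cube n T) {B : ℝ≥0} (hB : ∀ ξ, ‖u ξ‖₊ ≤ B)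
    (ξ : Rn n) : ‖classPeriodization N r u ξ‖₊ ≤ B := by
  obtain h | ⟨μ, h⟩ := classPeriodization_eventuallyEq r hN hu ξ
  · simp [h.eq_of_nhds]
  · rw [h.eq_of_nhds]
    exact hB _

theorem finite_sub_coeZ_mem_cube {n : ℕ} (a : ℝ) (ξ : Rn n) :
    {μ : Zn n | ξ - coeZ μ ∈ cube n a}.Finite := by
  refine (Set.finite_Icc (fun i => ⌊ξ i - a / 2⌋) (fun i => ⌈ξ i + a / 2⌉)).subset fun μ hμ => ?_
  have h (i : Fin n) : -a / 2 ≤ ξ i - μ i ∧ ξ i - μ i ≤ a / 2 := hμ i trivial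
  refine ⟨fun i => ?_, fun i => ?_⟩
  · exact_mod_cast (Int.floor_le _).trans (by linarith [(h i).2] : ξ i - a / 2 ≤ μ i)
  · exact_mod_cast (by linarith [(h i).1] : (μ i : ℝ) ≤ ξ i + a / 2).trans (Int.le_ceil _)

theorem summable_mul_localized {n : ℕ} {K : ℝ} {σf : Zn n → Zn n → Rn n × Rn n → ℂ}
    (hσ : ∀ μ ν, ∀ p : Rn n × Rn n, σf μ ν p ≠ 0 →
      p.1 - coeZ μ ∈ cube n K ∧ p.2 - coeZ ν ∈ cube n K)
    (c : Zn n × Zn n → ℂ) (p : Rn n × Rn n) :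
    Summable fun μν : Zn n × Zn n => c μν * σf μν.1 μν.2 p := by
  refine summable_of_hasFiniteSupport (((finite_sub_coeZ_mem_cube K p.1).prod
    (finite_sub_coeZ_mem_cube K p.2)).subset fun μν h => ?_)
  exact hσ _ _ _ (right_ne_zero_of_mul h)

theorem norm_tsum_classInd_le {n : ℕ} {K : ℝ} {σf : Zn n → Zn n → Rn n × Rn n → ℂ}
    (hσ : ∀ μ ν, ∀ p : Rn n × Rn n, σf μ ν p ≠ 0 →
      p.1 - coeZ μ ∈ cube n K ∧ p.2 - coeZ ν ∈ cube n K)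
    {N : ℕ} (hN : K < N) (r s : Fin n → ZMod N) {C : ℝ}
    (hC : ∀ μ ν p, ‖σf μ ν p‖ ≤ C) (p : Rn n × Rn n) :
    ‖∑' μν : Zn n × Zn n, classInd N r μν.1 * classInd N s μν.2 * σf μν.1 μν.2 p‖ ≤ C := by
  by_cases h : ∃ μν : Zn n × Zn n, classInd N r μν.1 * classInd N s μν.2 * σf μν.1 μν.2 p ≠ 0
  · obtain ⟨μν, h⟩ := h
    have h₁ := left_ne_zero_of_mul h
    rw [tsum_eq_single μν]
    · rw [(classInd_eq_zero_or_one N r _).resolve_left (left_ne_zero_of_mul h₁),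
        (classInd_eq_zero_or_one N s _).resolve_left (right_ne_zero_of_mul h₁), one_mul, one_mul]
      exact hC _ _ _
    · intro μν' hne
      by_contra h'
      have h₁' := left_ne_zero_of_mul h'
      have hp := hσ _ _ _ (right_ne_zero_of_mul h)
      have hp' := hσ _ _ _ (right_ne_zero_of_mul h')
      exact hne (Prod.ext
        (eq_of_classInd_ne_zero (left_ne_zero_of_mul h₁') (left_ne_zero_of_mul h₁) (d := 0)
          (by linarith) (by simp) hp'.1 hp.1)
        (eq_of_classInd_ne_zero (right_ne_zero_of_mul h₁') (right_ne_zero_of_mul h₁) (d := 0)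
          (by linarith) (by simp) hp'.2 hp.2))
  · push Not at h
    simp only [h, tsum_zero, norm_zero]
    exact (norm_nonneg _).trans (hC 0 0 p)

theorem measurable_tsum_mul_localized {n : ℕ} {K : ℝ} {σf : Zn n → Zn n → Rn n × Rn n → ℂ}
    (hσ : ∀ μ ν, ∀ p : Rn n × Rn n, σf μ ν p ≠ 0 →
      p.1 - coeZ μ ∈ cube n K ∧ p.2 - coeZ ν ∈ cube n K)
    (hm : ∀ μ ν, Measurable (σf μ ν)) (c : Zn n × Zn n → ℂ) :
    Measurable fun p => ∑' μν : Zn n × Zn n, c μν * σf μν.1 μν.2 p :=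
  measurable_of_tendsto_metrizable' Filter.atTop
    (fun S : Finset (Zn n × Zn n) => S.measurable_fun_sum fun μν _ => (hm μν.1 μν.2).const_mul _)
    (tendsto_pi_nhds.2 fun p => (summable_mul_localized hσ c p).hasSum)

theorem tsum_eq_sum_classPeriodization {n : ℕ} {K : ℝ} {σf : Zn n → Zn n → Rn n × Rn n → ℂ}
    (hσ : ∀ μ ν, ∀ p : Rn n × Rn n, σf μ ν p ≠ 0 →
      p.1 - coeZ μ ∈ cube n K ∧ p.2 - coeZ ν ∈ cube n K)
    {N : ℕ} [NeZero N] {T : ℝ} (hN : (K + T) / 2 < N)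
    {u v : Rn n → ℂ}
    (hu : Function.support u ⊆ cube n T) (hv : Function.support v ⊆ cube n T) (p : Rn n × Rn n) :
    ∑' μν : Zn n × Zn n, u (p.1 - coeZ μν.1) * v (p.2 - coeZ μν.2) * σf μν.1 μν.2 p =
      ∑ rs : (Fin n → ZMod N) × (Fin n → ZMod N),
        classPeriodization N rs.1 u p.1 * classPeriodization N rs.2 v p.2 *
          ∑' μν : Zn n × Zn n, classInd N rs.1 μν.1 * classInd N rs.2 μν.2 * σf μν.1 μν.2 p := by
  have key (w : Rn n → ℂ) (hw : Function.support w ⊆ cube n T) (r : Fin n → ZMod N) (μ : Zn n)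
      (ξ : Rn n) (hμ : classInd N r μ ≠ 0) (hξ : ξ - coeZ μ ∈ cube n K) :
      classPeriodization N r w ξ = w (ξ - coeZ μ) :=
    classPeriodization_eq hμ fun μ' hμ' h' => (eq_of_classInd_ne_zero hμ hμ' (d := 0)
      (by linarith) (by simp) hξ (hw h')).symm
  simp_rw [← tsum_mul_left]
  rw [← Summable.tsum_finsetSum fun rs _ => by
    simpa only [mul_assoc] using summable_mul_localized hσ (fun μν =>
      classPeriodization N rs.1 u p.1 * (classPeriodization N rs.2 v p.2 *
        (classInd N rs.1 μν.1 * classInd N rs.2 μν.2))) p]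
  refine tsum_congr fun μν => ?_
  have hsum : ∑ rs : (Fin n → ZMod N) × (Fin n → ZMod N),
      classInd N rs.1 μν.1 * classInd N rs.2 μν.2 = 1 := by
    rw [Fintype.sum_prod_type]
    simp only [← Finset.mul_sum, sum_classInd, mul_one]
  rw [← one_mul (_ * _ * _), ← hsum, Finset.sum_mul]
  refine Finset.sum_congr rfl fun rs _ => ?_
  by_cases h : classInd N rs.1 μν.1 * classInd N rs.2 μν.2 * σf μν.1 μν.2 p = 0
  · rw [h, mul_zero]
    linear_combination (u (p.1 - coeZ μν.1) * v (p.2 - coeZ μν.2)) * h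
  · have h₁ := left_ne_zero_of_mul h
    have hp := hσ _ _ _ (right_ne_zero_of_mul h)
    rw [key u hu _ _ _ (left_ne_zero_of_mul h₁) hp.1, key v hv _ _ _ (right_ne_zero_of_mul h₁) hp.2]
    ring

theorem integrable_Tbil_integrand {n : ℕ} {σ : Rn n × Rn n → ℂ} (hm : Measurable σ) {C : ℝ}
    (hC : ∀ p, ‖σ p‖ ≤ C) (f g : SchwartzMap (Rn n) ℂ) (x : Rn n) :
    Integrable fun p : Rn n × Rn n =>
      Complex.exp ((2 * Real.pi * Complex.I) * ((∑ i, x i * (p.1 i + p.2 i) : ℝ) : ℂ)) *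
        σ p * ft f p.1 * ft g p.2 := by
  simp_rw [mul_assoc _ (ft f _) (ft g _)]
  refine ((integrable_ft f).mul_prod (integrable_ft g)).bdd_mul (c := C)
    ((by fun_prop : Measurable _).mul hm).aestronglyMeasurable (.of_forall fun p => ?_)
  have h (t : ℝ) : (2 * Real.pi * Complex.I) * (t : ℂ) = ((2 * Real.pi * t : ℝ) : ℂ) * I := by
    push_cast
    ring
  rw [norm_mul, h, Complex.norm_exp_ofReal_mul_I, one_mul]
  exact hC p

theorem stronglyMeasurable_Tbil {n : ℕ} {σ : Rn n × Rn n → ℂ} (hm : Measurable σ)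
    (f g : SchwartzMap (Rn n) ℂ) : StronglyMeasurable (Tbil σ f g) := by
  refine StronglyMeasurable.integral_prod_right (Measurable.stronglyMeasurable ?_)
  have hf (h : SchwartzMap (Rn n) ℂ) : Measurable (ft h) := by
    rw [funext (ft_eq_schwartzFt h)]
    exact (SchwartzMap.continuous _).measurable
  have hp : Measurable fun q : Rn n × (Rn n × Rn n) => q.2 := measurable_snd
  have hf₁ := (hf f).comp (measurable_fst.comp hp)
  have hg₁ := (hf g).comp (measurable_snd.comp hp)
  have hσ₁ := hm.comp hp
  exact (((by fun_prop : Measurable _).mul hσ₁).mul hf₁).mul hg₁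

theorem localL2_eq_eLpNorm {n : ℕ} (h : Rn n → ℂ) (ν : Zn n) :
    localL2 h ν = eLpNorm (fun x => h (x + coeZ ν)) 2 (volume.restrict (cube n 1)) := by
  rw [eLpNorm_eq_lintegral_rpow_enorm_toReal (by simp) (by simp)]
  simp [localL2, enorm_eq_nnnorm]

theorem amalgamNorm_top_sum_le {n : ℕ} {ι : Type*} (s : Finset ι) {h : ι → Rn n → ℂ}
    (hm : ∀ i ∈ s, StronglyMeasurable (h i)) :
    amalgamNorm ⊤ (fun x => ∑ i ∈ s, h i x) ≤ ∑ i ∈ s, amalgamNorm ⊤ (h i) := by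
  simp only [amalgamNorm, if_true]
  refine iSup_le fun ν => ?_
  refine le_trans ?_ (Finset.sum_le_sum fun i _ => le_iSup (localL2 (h i)) ν)
  simp_rw [localL2_eq_eLpNorm]
  refine le_of_eq_of_le (congrArg (eLpNorm · 2 _) ?_)
    (eLpNorm_sum_le (s := s) (f := fun i x => h i (x + coeZ ν)) (p := 2) (fun i hi =>
      ((hm i hi).comp_measurable (measurable_add_const _)).aestronglyMeasurable) (by norm_num))
  ext x
  simp

theorem amalgamNorm_top_const_mul {n : ℕ} (c : ℂ) (h : Rn n → ℂ) :
    amalgamNorm ⊤ (fun x => c * h x) = ‖c‖ₑ * amalgamNorm ⊤ h := by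
  simp only [amalgamNorm, if_true, ENNReal.mul_iSup, localL2_eq_eLpNorm]
  exact iSup_congr fun ν => eLpNorm_const_smul c _ _ _

theorem ft_smul {n : ℕ} (c : ℂ) (f : SchwartzMap (Rn n) ℂ) (ξ : Rn n) :
    ft (c • f) ξ = c * ft f ξ := by
  rw [ft, ft, ← integral_const_mul]
  refine integral_congr_ae (.of_forall fun x => ?_)
  simp only [smul_apply, smul_eq_mul]
  ring

theorem Tbil_smul_smul {n : ℕ} (σ : Rn n × Rn n → ℂ) (a b : ℂ) (f g : SchwartzMap (Rn n) ℂ)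
    (x : Rn n) : Tbil σ (a • f) (b • g) x = (a * b) * Tbil σ f g x := by
  rw [Tbil, Tbil, ← integral_const_mul]
  refine integral_congr_ae (.of_forall fun p => ?_)
  simp only [ft_smul]
  ring

/-- Every Schwartz function is its `L²` norm times a Schwartz function that is normalized, or
is zero. -/
theorem exists_eq_smul_normalized {n : ℕ} (f : SchwartzMap (Rn n) ℂ) :
    ∃ (a : ℂ) (f₁ : SchwartzMap (Rn n) ℂ), ‖a‖ₑ = eLpNorm f 2 volume ∧ f = a • f₁ ∧
      (a = 0 ∨ eLpNorm f₁ 2 volume = 1) := by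
  have hfin := (SchwartzMap.memLp f 2 volume).eLpNorm_ne_top
  by_cases h0 : eLpNorm f 2 volume = 0
  · refine ⟨0, 0, by simp [h0], ?_, .inl rfl⟩
    rw [eLpNorm_eq_zero_iff f.continuous.aestronglyMeasurable (by simp)] at h0
    have := (f.continuous.ae_eq_iff_eq volume continuous_zero).1 h0
    ext x
    simp [congrFun this x]
  · have hpos : (eLpNorm f 2 volume).toReal ≠ 0 := ENNReal.toReal_ne_zero.2 ⟨h0, hfin⟩
    have ha : ‖((eLpNorm f 2 volume).toReal : ℂ)‖ₑ = eLpNorm f 2 volume := by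
      rw [← ofReal_norm, Complex.norm_real, Real.norm_of_nonneg ENNReal.toReal_nonneg,
        ENNReal.ofReal_toReal hfin]
    have hc : ((eLpNorm f 2 volume).toReal : ℂ) ≠ 0 := by exact_mod_cast hpos
    refine ⟨(eLpNorm f 2 volume).toReal, ((eLpNorm f 2 volume).toReal : ℂ)⁻¹ • f, ha, ?_, .inr ?_⟩
    · rw [smul_smul, mul_inv_cancel₀ hc, one_smul]
    · refine (eLpNorm_const_smul _ (⇑f) 2 volume).trans ?_
      rw [enorm_inv hc, ha, ENNReal.inv_mul_cancel h0 hfin]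

theorem amalgamNorm_top_Tbil_le {n : ℕ} (σ : Rn n × Rn n → ℂ) (f g : SchwartzMap (Rn n) ℂ) :
    amalgamNorm ⊤ (Tbil σ f g) ≤
      multNorm ⊤ σ * (eLpNorm f 2 volume * eLpNorm g 2 volume) := by
  obtain ⟨a, f₁, ha, hf, hf₁⟩ := exists_eq_smul_normalized f
  obtain ⟨b, g₁, hb, hg, hg₁⟩ := exists_eq_smul_normalized g
  rw [← ha, ← hb, hf, hg, funext (Tbil_smul_smul σ a b f₁ g₁), amalgamNorm_top_const_mul, enorm_mul,
    mul_comm]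
  obtain rfl | hf₁ := hf₁
  · simp
  obtain rfl | hg₁ := hg₁
  · simp
  gcongr
  exact le_iSup₂_of_le f₁ g₁ (le_iSup₂_of_le hf₁ hg₁ le_rfl)

theorem supNorm_lt_top {n : ℕ} {u : Rn n → ℂ} (hu : IsCcInfty u) : supNorm u < ∞ := by
  obtain ⟨C, hC⟩ := hu.1.continuous.bounded_above_of_compact_support hu.2
  refine (iSup_le fun x => ?_).trans_lt (ENNReal.ofReal_lt_top (r := C))
  rw [← enorm_eq_nnnorm, ← ofReal_norm]
  exact ENNReal.ofReal_le_ofReal (hC x)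

theorem nnnorm_le_supNorm_toNNReal {n : ℕ} {u : Rn n → ℂ} (hu : IsCcInfty u) (x : Rn n) :
    ‖u x‖₊ ≤ (supNorm u).toNNReal := by
  rw [← ENNReal.coe_le_coe, ENNReal.coe_toNNReal (supNorm_lt_top hu).ne]
  exact le_iSup (fun x => (‖u x‖₊ : ℝ≥0∞)) x

/-- STATEMENT 10 (Lemma: unconditional bounds imply bounds for product bump sums),
with constant depending only on `n`, `K`, `T`. -/
theorem statement10 (n : ℕ) (K T : ℝ) (hK : 0 < K) (hT : 0 < T) :
    ∃ c : ℝ≥0∞, c < ∞ ∧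
      ∀ (σf : Zn n → Zn n → Rn n × Rn n → ℂ) (M : ℝ≥0),
        (∀ μ ν, Measurable (σf μ ν)) →
        (∃ C : ℝ, ∀ μ ν p, ‖σf μ ν p‖ ≤ C) →
        (∀ μ ν, ∀ p : Rn n × Rn n, σf μ ν p ≠ 0 →
            p.1 - coeZ μ ∈ cube n K ∧ p.2 - coeZ ν ∈ cube n K) →
        (∀ α α' : Zn n → ℂ, (∀ μ, α μ = 0 ∨ α μ = 1) → (∀ ν, α' ν = 0 ∨ α' ν = 1) →
            multNorm ⊤ (fun p : Rn n × Rn n =>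
              ∑' μν : Zn n × Zn n, α μν.1 * α' μν.2 * σf μν.1 μν.2 p) ≤ (M : ℝ≥0∞)) →
        ∀ u v : Rn n → ℂ, IsCcInfty u → IsCcInfty v →
          Function.support u ⊆ cube n T → Function.support v ⊆ cube n T →
          multNorm ⊤ (fun p : Rn n × Rn n =>
              ∑' μν : Zn n × Zn n, u (p.1 - coeZ μν.1) * v (p.2 - coeZ μν.2) * σf μν.1 μν.2 p)
            ≤ c * supNorm u * supNorm v * M := by
  obtain ⟨N, hN⟩ := exists_nat_gt (K + T + 1)
  have : NeZero N := ⟨by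
    rintro rfl
    rw [Nat.cast_zero] at hN
    linarith⟩
  refine ⟨Fintype.card ((Fin n → ZMod N) × (Fin n → ZMod N)), ENNReal.natCast_lt_top _, ?_⟩
  intro σf M hm hbdd hσ hM u v hu hv hus hvs
  obtain ⟨C, hC⟩ := hbdd
  refine iSup₂_le fun f g => iSup₂_le fun hf hg => ?_
  choose F hF hF' using fun r : Fin n → ZMod N => exists_ft_eq_mul
    (classPeriodization_hasTemperateGrowth r (by linarith) hus hu)
    (nnnorm_classPeriodization_le r (by linarith) hus (nnnorm_le_supNorm_toNNReal hu)) f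
  choose G hG hG' using fun s : Fin n → ZMod N => exists_ft_eq_mul
    (classPeriodization_hasTemperateGrowth s (by linarith) hvs hv)
    (nnnorm_classPeriodization_le s (by linarith) hvs (nnnorm_le_supNorm_toNNReal hv)) g
  simp only [hf, mul_one, ENNReal.coe_toNNReal (supNorm_lt_top hu).ne] at hF'
  simp only [hg, mul_one, ENNReal.coe_toNNReal (supNorm_lt_top hv).ne] at hG'
  set σc : (Fin n → ZMod N) × (Fin n → ZMod N) → Rn n × Rn n → ℂ := fun rs p =>
    ∑' μν : Zn n × Zn n, classInd N rs.1 μν.1 * classInd N rs.2 μν.2 * σf μν.1 μν.2 p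
  have hσcm (rs) : Measurable (σc rs) := measurable_tsum_mul_localized hσ hm _
  have hT : Tbil (fun p : Rn n × Rn n =>
      ∑' μν : Zn n × Zn n, u (p.1 - coeZ μν.1) * v (p.2 - coeZ μν.2) * σf μν.1 μν.2 p) f g =
      fun x => ∑ rs, Tbil (σc rs) (F rs.1) (G rs.2) x := by
    ext x
    simp only [Tbil]
    rw [← integral_finsetSum _ fun rs _ => integrable_Tbil_integrand (hσcm rs)
      (norm_tsum_classInd_le hσ (by linarith) rs.1 rs.2 hC) _ _ _]
    refine integral_congr_ae (.of_forall fun p => ?_)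
    simp only
    rw [tsum_eq_sum_classPeriodization hσ (N := N) (by linarith) hus hvs, Finset.mul_sum,
      Finset.sum_mul, Finset.sum_mul]
    refine Finset.sum_congr rfl fun rs _ => ?_
    rw [hF, hG]
    ring
  rw [hT]
  refine (amalgamNorm_top_sum_le _ fun rs _ => stronglyMeasurable_Tbil (hσcm rs) _ _).trans ?_
  refine (Finset.sum_le_sum (g := fun _ => (M : ℝ≥0∞) * (supNorm u * supNorm v))
    fun rs _ => (amalgamNorm_top_Tbil_le _ _ _).trans ?_).trans ?_
  · gcongr
    · exact hM _ _ (classInd_eq_zero_or_one N rs.1) (classInd_eq_zero_or_one N rs.2)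
    · exact hF' _
    · exact hG' _
  · rw [Finset.sum_const, Finset.card_univ, nsmul_eq_mul]
    exact le_of_eq (by ring)
end
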